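/- arXiv:2601.18409 — 4 statements merged into one kernel-verified Lean document; each statement's English description precedes it below -/
import Mathlib

section
/- Let k be a natural number and α a real number. Define h : ℝ → ℝ by h(c) := |μ_k(c;α)|² (the squared complex modulus, i.e. the complex norm-square of (1-α) + α·(1 - i·c)^k). Then h(0) = 1, the first derivative of h at 0 equals 0, and the second derivative of h at 0 equals 2·(α²·k² - α·k·(k-1)). -/
theorem aux_re {f : ℝ → ℂ} {f' : ℂ} {c : ℝ} (hf : HasDerivAt f f' c) :
    HasDerivAt (fun x => (f x).re) f'.re c :=
  Complex.reCLM.hasFDerivAt.comp_hasDerivAt c hf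

theorem aux_im {f : ℝ → ℂ} {f' : ℂ} {c : ℝ} (hf : HasDerivAt f f' c) :
    HasDerivAt (fun x => (f x).im) f'.im c :=
  Complex.imCLM.hasFDerivAt.comp_hasDerivAt c hf

theorem aux_pow (n : ℕ) (c : ℝ) :
    HasDerivAt (fun x : ℝ => (1 - Complex.I * (x : ℂ)) ^ n)
      ((n : ℂ) * (1 - Complex.I * (c : ℂ)) ^ (n - 1) * (-Complex.I)) c := by
  have h1 : HasDerivAt (fun x : ℝ => (1 - Complex.I * (x : ℂ))) (-Complex.I) c := by
    have := ((Complex.ofRealCLM.hasDerivAt (x := c)).const_mul Complex.I).const_sub 1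
    simpa using this
  exact h1.pow n

theorem mola_mu_sq_taylor (k : ℕ) (α : ℝ) :
    let h : ℝ → ℝ := fun c =>
      Complex.normSq ((1 - (α : ℂ)) + (α : ℂ) * (1 - Complex.I * (c : ℂ)) ^ k)
    h 0 = 1 ∧ deriv h 0 = 0 ∧
      deriv (deriv h) 0 = 2 * (α ^ 2 * (k : ℝ) ^ 2 - α * (k : ℝ) * ((k : ℝ) - 1)) := by
  intro h
  let f : ℝ → ℂ := fun c => (1 - (α : ℂ)) + (α : ℂ) * (1 - Complex.I * (c : ℂ)) ^ k
  let g : ℝ → ℂ := fun c =>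
    (α : ℂ) * ((k : ℂ) * (1 - Complex.I * (c : ℂ)) ^ (k - 1) * (-Complex.I))
  have hf : ∀ c, HasDerivAt f (g c) c := fun c =>
    ((aux_pow k c).const_mul (α : ℂ)).const_add _
  have hg : HasDerivAt g ((α : ℂ) * ((k : ℂ) * (((k - 1 : ℕ) : ℂ) *
      (1 - Complex.I * ((0 : ℝ) : ℂ)) ^ (k - 1 - 1) * (-Complex.I)) * (-Complex.I))) 0 :=
    (((aux_pow (k - 1) 0).const_mul (k : ℂ)).mul_const (-Complex.I)).const_mul (α : ℂ)
  have hd : ∀ c, HasDerivAt h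
      (((g c).re * (f c).re + (f c).re * (g c).re) +
        ((g c).im * (f c).im + (f c).im * (g c).im)) c := fun c =>
    ((aux_re (hf c)).mul (aux_re (hf c))).add ((aux_im (hf c)).mul (aux_im (hf c)))
  have hdd : deriv h = fun c => (((g c).re * (f c).re + (f c).re * (g c).re) +
        ((g c).im * (f c).im + (f c).im * (g c).im)) := funext fun c => (hd c).deriv
  have f0 : f 0 = 1 := by simp [f]
  have g0 : g 0 = -((α * k : ℝ) : ℂ) * Complex.I := by simp [g]; ring
  have hk : (k : ℂ) * ((k - 1 : ℕ) : ℂ) = k * (k - 1) := by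
    cases k <;> simp
  have e : ((α : ℂ) * ((k : ℂ) * (((k - 1 : ℕ) : ℂ) *
      (1 - Complex.I * ((0 : ℝ) : ℂ)) ^ (k - 1 - 1) * (-Complex.I)) * (-Complex.I)))
      = ((-(α * (k * (k - 1))) : ℝ) : ℂ) := by
    push_cast
    rw [← hk]
    simp only [Complex.ofReal_zero, mul_zero, sub_zero, one_pow, mul_one]
    linear_combination (α * (k * ((k - 1 : ℕ) : ℂ))) * Complex.I_mul_I
  rw [e] at hg
  refine ⟨?_, ?_, ?_⟩
  · change Complex.normSq (f 0) = 1
    simp [f0]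
  · rw [hdd]; simp [f0, g0]
  · rw [hdd]
    have r1 := aux_re (hf 0)
    have r2 := aux_re hg
    have i1 := aux_im (hf 0)
    have i2 := aux_im hg
    have := (((r2.mul r1).add (r1.mul r2)).add ((i2.mul i1).add (i1.mul i2))).deriv
    refine this.trans ?_
    rw [f0, g0, Complex.ofReal_re, Complex.ofReal_im]
    simp
    ring
end

section
/- Fix a real number α with 0 < α < 1 and define, for a natural number k ≥ 1, Γ_max(α,k) := √( ((2-α)/α)^(2/k) - 1 ), where the power is the real power with real exponent 2/k and √ is the real square root. Then: (a) for all natural numbers k₁, k₂ with 2 ≤ k₁ < k₂ one has Γ_max(α,k₂) < Γ_max(α,k₁); and (b) the sequence k ↦ √k · Γ_max(α,k) tends to √(2·log((2-α)/α)) as k tends to infinity. -/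
theorem mola_gamma_max_antitone (α : ℝ) (hα0 : 0 < α) (hα1 : α < 1) :
    (∀ k₁ k₂ : ℕ, 2 ≤ k₁ → k₁ < k₂ →
      Real.sqrt (((2 - α) / α) ^ ((2 : ℝ) / (k₂ : ℝ)) - 1) <
        Real.sqrt (((2 - α) / α) ^ ((2 : ℝ) / (k₁ : ℝ)) - 1)) ∧
    Filter.Tendsto
      (fun k : ℕ => Real.sqrt (k : ℝ) * Real.sqrt (((2 - α) / α) ^ ((2 : ℝ) / (k : ℝ)) - 1))
      Filter.atTop (nhds (Real.sqrt (2 * Real.log ((2 - α) / α)))) := by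
  have hx : 1 < (2 - α) / α := by
    rw [lt_div_iff₀ hα0]; linarith
  generalize (2 - α) / α = x at hx
  have hx0 : 0 < x := by linarith
  constructor
  · intro k₁ k₂ h1 h2
    have h1' : (0 : ℝ) < k₁ := by exact_mod_cast (by omega : 0 < k₁)
    have h2' : (k₁ : ℝ) < k₂ := by exact_mod_cast h2
    have h3 : (0 : ℝ) < 2 / (k₂ : ℝ) := div_pos two_pos (h1'.trans h2')
    apply Real.sqrt_lt_sqrt
    · linarith [Real.one_lt_rpow hx h3]
    · have : (2 : ℝ) / k₂ < 2 / k₁ := div_lt_div_of_pos_left two_pos h1' h2'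
      linarith [Real.rpow_lt_rpow_of_exponent_lt hx this]
  · have hp : Filter.Tendsto (fun k : ℕ => (2 : ℝ) / (k : ℝ)) Filter.atTop
        (nhdsWithin 0 (Set.Ioi 0)) := by
      rw [tendsto_nhdsWithin_iff]
      refine ⟨tendsto_const_div_atTop_nhds_zero_nat 2, ?_⟩
      filter_upwards [Filter.eventually_gt_atTop 0] with k hk
      have : (0 : ℝ) < k := by exact_mod_cast hk
      exact div_pos two_pos this
    have hl := (((tendsto_rpow_sub_one_log hx0).comp hp).const_mul 2).sqrt
    refine hl.congr fun k => ?_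
    rw [← Real.sqrt_mul (Nat.cast_nonneg k)]
    congr 1
    simp only [Function.comp, inv_div]
    ring
end

section
/- Let E be a complete real inner product space (real Hilbert space) and F : E → E a map that is μ-strongly monotone and L-Lipschitz, with μ > 0, L > 0, and 0 < γ < 2μ/L². Let k ≥ 1 be a natural number and α a real with 0 < α ≤ 1. Define T z := z - γ·F z, let T^k denote its k-fold composition, define the LookAhead map S z := (1-α)·z + α·T^k z, and set q := √(1 - 2γμ + γ²L²) (real square root) and ρ := (1-α) + α·q^k. Then: (a) ‖S z₁ - S z₂‖ ≤ ρ·‖z₁ - z₂‖ for all z₁, z₂, and ρ < 1; (b) there exists a unique z* ∈ E with F z* = 0; and (c) every sequence with z_{t+1} = S z_t satisfies ‖z_t - z*‖ ≤ ρ^t · ‖z_0 - z*‖ for all t, hence converges to z*. -/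
open scoped RealInnerProductSpace

theorem lookahead_scsc_convergence
    (E : Type*) [NormedAddCommGroup E] [InnerProductSpace ℝ E] [CompleteSpace E]
    (F : E → E) (μ L γ : ℝ) (hμ : 0 < μ) (hL : 0 < L)
    (hmono : ∀ z₁ z₂ : E, μ * ‖z₁ - z₂‖ ^ 2 ≤ ⟪F z₁ - F z₂, z₁ - z₂⟫)
    (hlip : ∀ z₁ z₂ : E, ‖F z₁ - F z₂‖ ≤ L * ‖z₁ - z₂‖)
    (hγ0 : 0 < γ) (hγ : γ < 2 * μ / L ^ 2)
    (k : ℕ) (hk : 1 ≤ k) (α : ℝ) (hα0 : 0 < α) (hα1 : α ≤ 1)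
    (T S : E → E) (hT : ∀ z, T z = z - γ • F z)
    (hS : ∀ z, S z = (1 - α) • z + α • T^[k] z)
    (q ρ : ℝ) (hq : q = Real.sqrt (1 - 2 * γ * μ + γ ^ 2 * L ^ 2))
    (hρ : ρ = (1 - α) + α * q ^ k) :
    (∀ z₁ z₂ : E, ‖S z₁ - S z₂‖ ≤ ρ * ‖z₁ - z₂‖) ∧ ρ < 1 ∧
    (∃! zs : E, F zs = 0) ∧
    (∀ zs : E, F zs = 0 → ∀ z : ℕ → E, (∀ t : ℕ, z (t + 1) = S (z t)) →
      (∀ t : ℕ, ‖z t - zs‖ ≤ ρ ^ t * ‖z 0 - zs‖) ∧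
      Filter.Tendsto z Filter.atTop (nhds zs)) := by
  have hL2 : 0 < L ^ 2 := by positivity
  have hγ' : γ * L ^ 2 < 2 * μ := (lt_div_iff₀ hL2).1 hγ
  have hq0 : 0 ≤ q := hq ▸ Real.sqrt_nonneg _
  have hc1 : 1 - 2 * γ * μ + γ ^ 2 * L ^ 2 < 1 := by nlinarith
  have hq1 : q < 1 := by
    rw [hq, Real.sqrt_lt' one_pos]; linarith
  have hcq : 1 - 2 * γ * μ + γ ^ 2 * L ^ 2 ≤ q ^ 2 := by
    rcases le_total 0 (1 - 2 * γ * μ + γ ^ 2 * L ^ 2) with h | h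
    · rw [hq, Real.sq_sqrt h]
    · exact h.trans (sq_nonneg q)
  have hTc : ∀ z₁ z₂ : E, ‖T z₁ - T z₂‖ ≤ q * ‖z₁ - z₂‖ := by
    intro z₁ z₂
    have e : T z₁ - T z₂ = (z₁ - z₂) - γ • (F z₁ - F z₂) := by
      rw [hT, hT, smul_sub]; abel
    have h1 := hmono z₁ z₂
    have h2 := hlip z₁ z₂
    refine (sq_le_sq₀ (norm_nonneg _) (by positivity)).1 ?_
    rw [e, norm_sub_sq_real, inner_smul_right, norm_smul, Real.norm_of_nonneg hγ0.le,
      real_inner_comm]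
    have h3 : ‖F z₁ - F z₂‖ ^ 2 ≤ (L * ‖z₁ - z₂‖) ^ 2 := by gcongr
    have h4 := mul_le_mul_of_nonneg_left h3 (sq_nonneg γ)
    have h5 := mul_le_mul_of_nonneg_left h1 hγ0.le
    have h6 := mul_le_mul_of_nonneg_right hcq (sq_nonneg ‖z₁ - z₂‖)
    nlinarith
  have hTk : ∀ (n : ℕ) (z₁ z₂ : E), ‖T^[n] z₁ - T^[n] z₂‖ ≤ q ^ n * ‖z₁ - z₂‖ := by
    intro n
    induction n with
    | zero => intro z₁ z₂; simp
    | succ n ih =>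
      intro z₁ z₂
      rw [Function.iterate_succ_apply, Function.iterate_succ_apply, pow_succ, mul_assoc]
      exact (ih _ _).trans (mul_le_mul_of_nonneg_left (hTc _ _) (by positivity))
  have hSc : ∀ z₁ z₂ : E, ‖S z₁ - S z₂‖ ≤ ρ * ‖z₁ - z₂‖ := by
    intro z₁ z₂
    have e : S z₁ - S z₂ = (1 - α) • (z₁ - z₂) + α • (T^[k] z₁ - T^[k] z₂) := by
      rw [hS, hS, smul_sub, smul_sub]; abel
    rw [e]
    refine (norm_add_le _ _).trans ?_
    rw [norm_smul, norm_smul, Real.norm_of_nonneg hα0.le,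
      Real.norm_of_nonneg (sub_nonneg.2 hα1), hρ]
    have := mul_le_mul_of_nonneg_left (hTk k z₁ z₂) hα0.le
    nlinarith
  have hρ0 : 0 ≤ ρ := by
    have : 0 ≤ α * q ^ k := by positivity
    linarith
  have hρ1 : ρ < 1 := by
    have : q ^ k < 1 := pow_lt_one₀ hq0 hq1 (by omega)
    nlinarith
  have hfix : ∀ z, F z = 0 ↔ T z = z := by
    intro z
    rw [hT, sub_eq_self, smul_eq_zero]
    simp [hγ0.ne']
  refine ⟨hSc, hρ1, ?_, ?_⟩
  · have hcon : ContractingWith ⟨q, hq0⟩ T := by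
      refine ⟨by exact_mod_cast hq1, LipschitzWith.of_dist_le_mul fun x y => ?_⟩
      rw [dist_eq_norm, dist_eq_norm]
      exact hTc x y
    refine ⟨hcon.fixedPoint T, (hfix _).2 hcon.fixedPoint_isFixedPt, fun y hy => ?_⟩
    exact hcon.fixedPoint_unique ((hfix y).1 hy)
  · intro zs hzs z hz
    have hSz : S zs = zs := by
      have : T^[k] zs = zs := Function.iterate_fixed ((hfix zs).1 hzs) k
      rw [hS, this, ← add_smul]; simp
    have hb : ∀ t : ℕ, ‖z t - zs‖ ≤ ρ ^ t * ‖z 0 - zs‖ := by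
      intro t
      induction t with
      | zero => simp
      | succ t ih =>
        have h := hSc (z t) zs
        rw [hSz, ← hz] at h
        rw [pow_succ', mul_assoc]
        exact h.trans (mul_le_mul_of_nonneg_left ih hρ0)
    refine ⟨hb, ?_⟩
    rw [tendsto_iff_norm_sub_tendsto_zero]
    refine squeeze_zero (fun _ => norm_nonneg _) hb ?_
    simpa using (tendsto_pow_atTop_nhds_zero_of_lt_one hρ0 hρ1).mul_const ‖z 0 - zs‖
end

section
/- Let E be a real inner product space, F : E → E any map, γ and α real numbers, k a natural number, and p ∈ E. Let z : ℕ → E satisfy z(j+1) = z(j) - γ·F(z(j)) for all j < k, and set w := (1-α)·z(0) + α·z(k). Then 2αγ·∑_{j=0}^{k-1} ⟨F(z(j)), z(j) - p⟩ = ‖z(0) - p‖² - ‖w - p‖² + αγ²·∑_{j=0}^{k-1} ‖F(z(j))‖² - α(1-α)·‖z(k) - z(0)‖². -/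
open scoped RealInnerProductSpace

theorem lookahead_cycle_energy_identity
    (E : Type*) [NormedAddCommGroup E] [InnerProductSpace ℝ E]
    (F : E → E) (γ α : ℝ) (k : ℕ) (p : E) (z : ℕ → E)
    (hz : ∀ j : ℕ, j < k → z (j + 1) = z j - γ • F (z j)) :
    2 * α * γ * ∑ j ∈ Finset.range k, ⟪F (z j), z j - p⟫ =
      ‖z 0 - p‖ ^ 2 - ‖((1 - α) • z 0 + α • z k) - p‖ ^ 2 +
        α * γ ^ 2 * ∑ j ∈ Finset.range k, ‖F (z j)‖ ^ 2 -
        α * (1 - α) * ‖z k - z 0‖ ^ 2 := by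
  have tel : ∀ n : ℕ, n ≤ k → 2 * γ * ∑ j ∈ Finset.range n, ⟪F (z j), z j - p⟫ =
      ‖z 0 - p‖ ^ 2 - ‖z n - p‖ ^ 2 + γ ^ 2 * ∑ j ∈ Finset.range n, ‖F (z j)‖ ^ 2 := by
    intro n
    induction n with
    | zero => intro _; simp
    | succ n ih =>
      intro hn
      have h1 := ih (by omega)
      have h2 : ‖z (n + 1) - p‖ ^ 2 =
          ‖z n - p‖ ^ 2 - 2 * γ * ⟪F (z n), z n - p⟫ + γ ^ 2 * ‖F (z n)‖ ^ 2 := by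
        have e : z (n + 1) - p = (z n - p) - γ • F (z n) := by
          rw [hz n (by omega)]; abel
        rw [e, norm_sub_sq_real, inner_smul_right, norm_smul, mul_pow, Real.norm_eq_abs,
          sq_abs, real_inner_comm]
        ring
      rw [Finset.sum_range_succ, Finset.sum_range_succ, h2]
      linear_combination h1
  have hk := tel k le_rfl
  have e1 : ((1 - α) • z 0 + α • z k) - p = (1 - α) • (z 0 - p) + α • (z k - p) := by
    module
  have e2 : z k - z 0 = (z k - p) - (z 0 - p) := by abel
  have h3 : ‖((1 - α) • z 0 + α • z k) - p‖ ^ 2 =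
      (1 - α) * ‖z 0 - p‖ ^ 2 + α * ‖z k - p‖ ^ 2 - α * (1 - α) * ‖z k - z 0‖ ^ 2 := by
    rw [e1, e2, norm_add_sq_real, norm_sub_sq_real (z k - p) (z 0 - p), inner_smul_left, inner_smul_right,
      norm_smul, norm_smul, mul_pow, mul_pow, Real.norm_eq_abs, Real.norm_eq_abs, sq_abs,
      sq_abs, real_inner_comm (z 0 - p) (z k - p)]
    simp only [conj_trivial]
    ring
  rw [h3]
  linear_combination α * hk
end
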